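/- Let E be a Gysin functor on a finitary lextensive category C and X an object of C. Then the map D : E(X) → C_E(X, X) given by D(a) := Δ_!(a) is a ring homomorphism from E(X) to the endomorphism ring (C_E(X, X), ∘, i_X); that is, D(ab) = D(b) ∘ D(a) = D(a) ∘ D(b) and D(1) = i_X, and D is additive. Moreover (Da)^* = Da, where α^* := t^*(α) for the transposition t : X × X → X × X. -/

import Mathlib

open CategoryTheory CategoryTheory.Limits

universe v u

/-- A Gysin functor on a finitary lextensive category `C`. -/
structure GysinFunctor (C : Type u) [Category.{v} C] [HasFiniteLimits C]
    [HasFiniteCoproducts C] [FinitaryExtensive C] where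
  /-- The underlying rings. -/
  E : C → Type v
  commRing : ∀ X : C, CommRing (E X)
  /-- Contravariant functoriality (pullback), by ring maps. -/
  pull : ∀ {X Y : C}, (X ⟶ Y) → (E Y →+* E X)
  pull_id : ∀ X : C, pull (𝟙 X) = RingHom.id (E X)
  pull_comp : ∀ {X Y Z : C} (f : X ⟶ Y) (g : Y ⟶ Z),
    pull (f ≫ g) = (pull f).comp (pull g)
  /-- Covariant functoriality (pushforward/Gysin maps), by additive maps. -/
  push : ∀ {X Y : C}, (X ⟶ Y) → (E X →+ E Y)
  push_id : ∀ X : C, push (𝟙 X) = AddMonoidHom.id (E X)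
  push_comp : ∀ {X Y Z : C} (f : X ⟶ Y) (g : Y ⟶ Z),
    push (f ≫ g) = (push g).comp (push f)
  /-- Zero axiom: `E ∅ = 0`. -/
  zero : Subsingleton (E (⊥_ C))
  /-- Behavior on sums. -/
  coprod_bij : ∀ X Y : C, Function.Bijective
    (fun a : E (X ⨿ Y) => (pull coprod.inl a, pull coprod.inr a))
  /-- Push-product axiom. -/
  push_product : ∀ {X X' Y Y' : C} (f : X ⟶ X') (g : Y ⟶ Y') (a : E X) (b : E Y),
    push (prod.map f g) (pull prod.fst a * pull prod.snd b)
      = pull prod.fst (push f a) * pull prod.snd (push g b)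
  /-- Push-pull axiom. -/
  push_pull : ∀ {A B C' D' : C} (f : A ⟶ B) (p : A ⟶ C') (q : B ⟶ D') (g : C' ⟶ D'),
    IsPullback f p q g → ∀ a : E C', push f (pull p a) = pull q (push g a)

namespace GysinFunctor

attribute [instance] GysinFunctor.commRing

variable {C : Type u} [Category.{v} C] [HasFiniteLimits C]
  [HasFiniteCoproducts C] [FinitaryExtensive C] (G : GysinFunctor C)

/-- Hom-groups of the category of correspondences: `C_E(A, B) = E(B × A)`. -/
noncomputable def Hom (A B : C) : Type v := G.E (B ⨯ A)

noncomputable instance (A B : C) : AddCommGroup (G.Hom A B) :=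
  inferInstanceAs (AddCommGroup (G.E (B ⨯ A)))

/-- Composition in the category of correspondences. -/
noncomputable def comp {A B Cc : C} (β : G.Hom B Cc) (α : G.Hom A B) : G.Hom A Cc :=
  G.push (prod.map prod.fst (𝟙 A) : (Cc ⨯ B) ⨯ A ⟶ Cc ⨯ A)
    (G.pull (prod.fst : (Cc ⨯ B) ⨯ A ⟶ Cc ⨯ B) β *
      G.pull (prod.map prod.snd (𝟙 A) : (Cc ⨯ B) ⨯ A ⟶ B ⨯ A) α)

/-- The identity morphism `i_A = Δ_!(1)` in the category of correspondences. -/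
noncomputable def ident (A : C) : G.Hom A A := G.push (diag A) 1

/-- `Rf`, the forward map associated to `f : A ⟶ B`. -/
noncomputable def Rmor {A B : C} (f : A ⟶ B) : G.Hom A B :=
  G.push (prod.lift f (𝟙 A)) 1

/-- `If`, the transfer map associated to `f : A ⟶ B`. -/
noncomputable def Imor {A B : C} (f : A ⟶ B) : G.Hom B A :=
  G.push (prod.lift (𝟙 A) f) 1

/-- `Da`, the diagonal endomorphism associated to `a ∈ E(A)`. -/
noncomputable def Dmor {A : C} (a : G.E A) : G.Hom A A := G.push (diag A) a

/-- The duality anti-automorphism on hom-groups. -/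
noncomputable def star {A B : C} (α : G.Hom A B) : G.Hom B A :=
  G.pull (prod.braiding A B).hom α

end GysinFunctor

namespace CategoryTheory.IsPullback

variable {C : Type u} [Category.{v} C] [HasBinaryProducts C]

/-- The graph of `f` is the pullback of the diagonal along `f × 𝟙`. -/
lemma of_graph_diag {A B : C} (f : A ⟶ B) :
    IsPullback f (prod.lift (𝟙 A) f) (diag B) (prod.map f (𝟙 B)) := by
  refine ⟨⟨by ext <;> simp [prod.lift_fst, prod.lift_snd]⟩,
    ⟨PullbackCone.IsLimit.mk _ (fun s => s.snd ≫ prod.fst) ?_ ?_ ?_⟩⟩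
  · intro s
    have h := s.condition =≫ prod.fst
    simpa [prod.lift_fst] using h.symm
  · intro s
    have h₁ := s.condition =≫ prod.fst
    have h₂ := s.condition =≫ prod.snd
    ext
    · simp [prod.lift_fst]
    · simp only [Category.assoc, prod.lift_fst, prod.lift_snd, prod.map_fst, prod.map_snd,
        Category.comp_id] at h₁ h₂ ⊢
      rw [← h₁, h₂]
  · intro s m _ h
    simpa [prod.lift_fst] using h =≫ prod.fst

/-- `f × 𝟙` is the pullback of `f` along the first projection. -/
lemma of_map_id_fst {A B : C} (f : A ⟶ B) (Y : C) :
    IsPullback (prod.map f (𝟙 Y)) prod.fst prod.fst f := by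
  refine ⟨⟨by simp⟩, ⟨PullbackCone.IsLimit.mk _
    (fun s => prod.lift s.snd (s.fst ≫ prod.snd)) ?_ ?_ ?_⟩⟩
  · intro s
    have h := s.condition
    ext <;> simp [h, prod.lift_fst, prod.lift_snd]
  · intro s
    simp [prod.lift_fst]
  · intro s m h₁ h₂
    ext
    · simpa [prod.lift_fst] using h₂
    · simpa [prod.lift_snd] using h₁ =≫ prod.snd

end CategoryTheory.IsPullback

namespace GysinFunctor

variable {C : Type u} [Category.{v} C] [HasFiniteLimits C]
  [HasFiniteCoproducts C] [FinitaryExtensive C] (G : GysinFunctor C)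

lemma pull_comp_apply {X Y Z : C} (f : X ⟶ Y) (g : Y ⟶ Z) (a : G.E Z) :
    G.pull f (G.pull g a) = G.pull (f ≫ g) a := by
  rw [G.pull_comp]; rfl

lemma push_comp_apply {X Y Z : C} (f : X ⟶ Y) (g : Y ⟶ Z) (a : G.E X) :
    G.push g (G.push f a) = G.push (f ≫ g) a := by
  rw [G.push_comp]; rfl

lemma pull_id_apply {X : C} (a : G.E X) : G.pull (𝟙 X) a = a := by
  rw [G.pull_id]; rfl

lemma push_id_apply {X : C} (a : G.E X) : G.push (𝟙 X) a = a := by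
  rw [G.push_id]; rfl

/-- The projection formula. -/
lemma push_mul_pull {A B : C} (f : A ⟶ B) (a : G.E A) (b : G.E B) :
    G.push f (a * G.pull f b) = G.push f a * b := by
  have h := G.push_pull _ _ _ _ (IsPullback.of_graph_diag f)
    (G.pull prod.fst a * G.pull prod.snd b)
  rw [G.push_product] at h
  simpa [pull_comp_apply, prod.lift_fst, prod.lift_snd, pull_id_apply, push_id_apply] using h

lemma comp_Dmor_Dmor {X : C} (a b : G.E X) :
    G.comp (G.Dmor b) (G.Dmor a) = G.Dmor (b * a) := by
  have h : G.pull (prod.fst : (X ⨯ X) ⨯ X ⟶ X ⨯ X) (G.push (diag X) b) =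
      G.push (prod.map (diag X) (𝟙 X)) (G.pull prod.fst b) :=
    (G.push_pull _ _ _ _ (IsPullback.of_map_id_fst (diag X) X) b).symm
  have hs : prod.map (diag X) (𝟙 X) ≫ prod.map prod.snd (𝟙 X) = 𝟙 (X ⨯ X) := by
    ext <;> simp [prod.lift_snd]
  have hf : prod.map (diag X) (𝟙 X) ≫ prod.map prod.fst (𝟙 X) = 𝟙 (X ⨯ X) := by
    ext <;> simp [prod.lift_fst]
  have hd : G.pull (diag X) (G.pull prod.fst b) = b := by
    rw [pull_comp_apply, prod.lift_fst, pull_id_apply]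
  unfold comp Dmor
  rw [h, ← push_mul_pull, push_comp_apply, pull_comp_apply, hs, hf, pull_id_apply,
    push_id_apply, mul_comm, ← push_mul_pull, hd, mul_comm]

lemma star_Dmor {X : C} (a : G.E X) : G.star (G.Dmor a) = G.Dmor a := by
  have hp : IsPullback (diag X) (𝟙 X) (prod.braiding X X).hom (diag X) :=
    IsPullback.of_vert_isIso ⟨by ext <;> simp [prod.lift_fst, prod.lift_snd]⟩
  have h := G.push_pull _ _ _ _ hp a
  rw [pull_id_apply] at h
  exact h.symm

end GysinFunctor

open GysinFunctor in
/-- `D : E(X) → C_E(X, X)` is a ring homomorphism to the endomorphism ring, and `(Da)^* = Da`. -/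
theorem gysinFunctor_D_ringHom
    {C : Type u} [Category.{v} C] [HasFiniteLimits C]
    [HasFiniteCoproducts C] [FinitaryExtensive C] (G : GysinFunctor C) (X : C) :
    (∀ a b : G.E X, G.Dmor (a * b) = G.comp (G.Dmor b) (G.Dmor a) ∧
      G.Dmor (a * b) = G.comp (G.Dmor a) (G.Dmor b)) ∧
    G.Dmor (1 : G.E X) = G.ident X ∧
    (∀ a b : G.E X, G.Dmor (a + b) = G.Dmor a + G.Dmor b) ∧
    (∀ a : G.E X, G.star (G.Dmor a) = G.Dmor a) := by
  refine ⟨fun a b => ⟨?_, (G.comp_Dmor_Dmor b a).symm⟩, rfl,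
    map_add (G.push (diag X)), G.star_Dmor⟩
  rw [G.comp_Dmor_Dmor, mul_comm]
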